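/- Fix 0 < q < 1 and integers N ≥ 2, 1 ≤ n ≤ N-1. For 0 < α < q^{-1}, the affine q-Krawtchouk polynomial K̂_n^{(α)}(·;q) has n distinct real zeros x_1(α) < ⋯ < x_n(α), and for each j ∈ {1,...,n} the zero x_j(α) is a strictly decreasing function of α on (0, q^{-1}). -/

import Mathlib

/-- q-Pochhammer symbol `(a;q)_k = ∏_{j=0}^{k-1} (1 - a q^j)`. -/
noncomputable def qpoch (q a : ℝ) (k : ℕ) : ℝ := ∏ j ∈ Finset.range k, (1 - a * q ^ j)

/-- Affine q-Krawtchouk polynomial `K̂_n^{(α)}(x;q)`. -/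
noncomputable def affineQKrawtchoukPoly (q : ℝ) (N n : ℕ) (α x : ℝ) : ℝ :=
  ∑ k ∈ Finset.range (n + 1),
    qpoch q (q ^ (-(n : ℤ))) k * qpoch q x k /
      (qpoch q (α * q) k * qpoch q (q ^ ((1 : ℤ) - (N : ℤ))) k * qpoch q q k) * q ^ k

open Polynomial

theorem qpoch_zero (q a : ℝ) : qpoch q a 0 = 1 := by simp [qpoch]

theorem qpoch_succ (q a : ℝ) (k : ℕ) : qpoch q a (k + 1) = qpoch q a k * (1 - a * q ^ k) :=
  Finset.prod_range_succ _ _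

theorem qpoch_succ' (q a : ℝ) (k : ℕ) : qpoch q a (k + 1) = (1 - a) * qpoch q (a * q) k := by
  rw [qpoch, Finset.prod_range_succ', mul_comm]
  simp only [pow_zero, mul_one, qpoch]
  congr 1
  exact Finset.prod_congr rfl fun j _ => by ring

/-- Coefficients of the basic hypergeometric expansion in the basis `(x;q)_k`. -/
noncomputable def qhypCoeff (q A B a : ℝ) (k : ℕ) : ℝ :=
  qpoch q A k / (qpoch q a k * qpoch q B k * qpoch q q k) * q ^ k

theorem qhypCoeff_succ (q A B a : ℝ) (k : ℕ) :
    qhypCoeff q A B a (k + 1) = qhypCoeff q A B a k *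
      ((1 - A * q ^ k) * q / ((1 - a * q ^ k) * (1 - B * q ^ k) * (1 - q * q ^ k))) := by
  simp only [qhypCoeff, qpoch_succ, pow_succ, div_eq_mul_inv, mul_inv]
  ring

theorem qhypCoeff_succ' (q A B a : ℝ) (k : ℕ) :
    qhypCoeff q A B a (k + 1) = qhypCoeff q (A * q) (B * q) (a * q) k *
      ((1 - A) * q / ((1 - a) * (1 - B) * (1 - q * q ^ k))) := by
  rw [qhypCoeff, qpoch_succ q q]
  simp only [qhypCoeff, qpoch_succ', pow_succ, div_eq_mul_inv, mul_inv]
  ring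

theorem affineQKrawtchoukPoly_eq (q : ℝ) (M n : ℕ) (α x : ℝ) :
    affineQKrawtchoukPoly q (M + 1) n α x =
      ∑ k ∈ Finset.range (n + 1), qhypCoeff q (q ^ n)⁻¹ (q ^ M)⁻¹ (α * q) k * qpoch q x k := by
  refine Finset.sum_congr rfl fun k _ => ?_
  have h : (1 : ℤ) - ((M + 1 : ℕ) : ℤ) = -(M : ℤ) := by push_cast; ring
  rw [h, zpow_neg, zpow_neg, zpow_natCast, zpow_natCast, qhypCoeff]
  ring

theorem qpoch_backward {q : ℝ} (M k : ℕ) (α x : ℝ) (hq : q ≠ 0) (hx : x ≠ 0) :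
    (1 - α * q / x) * (1 - q ^ M * x) * qpoch q x k
        - α * q * (1 - 1 / x) * qpoch q (x * q) k =
      q ^ M / q ^ k * qpoch q x (k + 1)
        + (1 - q ^ M / q ^ k) * (1 - α * q * q ^ k) * qpoch q x k := by
  have h : (1 - 1 / x) * qpoch q (x * q) k = -(1 / x) * (qpoch q x k * (1 - x * q ^ k)) := by
    rw [← qpoch_succ, qpoch_succ']; field_simp; ring
  rw [mul_assoc (α * q), h, qpoch_succ]
  have := pow_ne_zero k hq
  field_simp
  ring

/-- Backward shift relation. -/
theorem affineQKrawtchoukPoly_backward {q : ℝ} (hq0 : 0 < q) (hq1 : q < 1) (M n : ℕ) (hn : n ≤ M)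
    {α x : ℝ} (hα : 0 < α) (hα1 : α * q < 1) (hx : x ≠ 0) :
    (1 - α * q / x) * (1 - q ^ (M + 1) * x) * affineQKrawtchoukPoly q (M + 1) n (α * q) x
        - α * q * (1 - 1 / x) * affineQKrawtchoukPoly q (M + 1) n (α * q) (x * q) =
      (1 - q ^ (M + 1)) * (1 - α * q) * affineQKrawtchoukPoly q (M + 2) (n + 1) α x := by
  simp only [affineQKrawtchoukPoly_eq]
  have hq := hq0.ne'
  set c : ℕ → ℝ := qhypCoeff q (q ^ n)⁻¹ (q ^ M)⁻¹ (α * q * q) with hc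
  set d : ℕ → ℝ := qhypCoeff q (q ^ (n + 1))⁻¹ (q ^ (M + 1))⁻¹ (α * q) with hd
  have h1 : ∀ k, q * q ^ k ≠ 1 := fun k => by
    have := pow_lt_one₀ hq0.le hq1 (Nat.succ_ne_zero k)
    rw [pow_succ'] at this; exact this.ne
  have h2 : ∀ k, α * q * q * q ^ k ≠ 1 := fun k => by
    have : q * q ^ k ≤ 1 := by rw [← pow_succ']; exact pow_le_one₀ hq0.le hq1.le
    have : α * q * (q * q ^ k) ≤ α * q * 1 := by gcongr
    nlinarith
  have hcn : c (n + 1) = 0 := by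
    rw [hc, qhypCoeff_succ, inv_mul_cancel₀ (pow_ne_zero n hq)]; simp
  have hrec : ∀ k ∈ Finset.range (n + 1), (1 - q ^ (M + 1)) * (1 - α * q) * d (k + 1) =
      c k * (q ^ (M + 1) / q ^ k)
        + c (k + 1) * ((1 - q ^ (M + 1) / q ^ (k + 1)) * (1 - α * q * q ^ (k + 1))) := by
    intro k hk
    have hkn : k ≤ n := Nat.lt_succ_iff.1 (Finset.mem_range.1 hk)
    have hk1 : 1 - q * q ^ k ≠ 0 := sub_ne_zero.2 (h1 k).symm
    have hM1 : 1 - q * q ^ M ≠ 0 := sub_ne_zero.2 (h1 M).symm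
    have ha : 1 - q * α ≠ 0 := by linarith
    have hak : 1 - q ^ k * q ^ 2 * α ≠ 0 := by
      convert sub_ne_zero.2 (h2 k).symm using 1; ring
    have hck : c (k + 1) = c k * ((1 - (q ^ n)⁻¹ * q ^ k) * q /
        ((1 - α * q * q * q ^ k) * (1 - (q ^ M)⁻¹ * q ^ k) * (1 - q * q ^ k))) :=
      qhypCoeff_succ _ _ _ _ _
    have hd' : (1 - q ^ (M + 1)) * (1 - α * q) * d (k + 1) =
        c k * (q ^ (M + 1) * q / q ^ (n + 1) * (1 - q ^ (n + 1)) / (1 - q * q ^ k)) := by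
      have e1 : (q ^ (n + 1))⁻¹ * q = (q ^ n)⁻¹ := by field_simp; ring
      have e2 : (q ^ (M + 1))⁻¹ * q = (q ^ M)⁻¹ := by field_simp; ring
      rw [hd, qhypCoeff_succ', e1, e2]
      rw [← hc]
      have hM2 : 1 - (q ^ (M + 1))⁻¹ = -(1 - q * q ^ M) / q ^ (M + 1) := by field_simp; ring
      have hn2 : 1 - (q ^ (n + 1))⁻¹ = -(1 - q ^ (n + 1)) / q ^ (n + 1) := by field_simp; ring
      rw [hM2, hn2]
      have : q ^ (M + 1) = q * q ^ M := pow_succ' _ _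
      rw [this]
      field_simp
    have hb : c (k + 1) * ((1 - q ^ (M + 1) / q ^ (k + 1)) * (1 - α * q * q ^ (k + 1))) =
        - c k * ((1 - q ^ k / q ^ n) * q * (q ^ M / q ^ k) / (1 - q * q ^ k)) := by
      have e3 : q ^ (M + 1) / q ^ (k + 1) = q ^ M / q ^ k := by
        rw [pow_succ, pow_succ, mul_div_mul_right _ _ hq]
      have e4 : 1 - α * q * q ^ (k + 1) = 1 - α * q * q * q ^ k := by ring
      rw [hck, e3, e4]
      rcases eq_or_ne k M with rfl | hkM
      · obtain rfl : k = n := le_antisymm hkn hn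
        simp [pow_ne_zero k hq]
      · have hlt : k < M := lt_of_le_of_ne (hkn.trans hn) hkM
        have hlt' : q ^ M - q ^ k ≠ 0 :=
          (sub_neg.2 (pow_lt_pow_right_of_lt_one₀ hq0 hq1 hlt)).ne
        have e5 : 1 - (q ^ M)⁻¹ * q ^ k = (q ^ M - q ^ k) / q ^ M := by field_simp
        have e6 : 1 - q ^ M / q ^ k = -(q ^ M - q ^ k) / q ^ k := by field_simp; ring
        rw [e5, e6]
        field_simp
    rw [hd', hb]
    have := pow_ne_zero k hq
    field_simp
    ring
  have h0 : (1 - q ^ (M + 1)) * (1 - α * q) * d 0 =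
      c 0 * ((1 - q ^ (M + 1) / q ^ 0) * (1 - α * q * q ^ 0)) := by
    simp [hc, hd, qhypCoeff, qpoch_zero]
  calc _ = ∑ k ∈ Finset.range (n + 1), c k * (q ^ (M + 1) / q ^ k) * qpoch q x (k + 1)
        + ∑ k ∈ Finset.range (n + 1),
          c k * ((1 - q ^ (M + 1) / q ^ k) * (1 - α * q * q ^ k)) * qpoch q x k := by
        rw [Finset.mul_sum, Finset.mul_sum, ← Finset.sum_sub_distrib, ← Finset.sum_add_distrib]
        refine Finset.sum_congr rfl fun k _ => ?_
        linear_combination c k * qpoch_backward (M + 1) k α x hq hx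
    _ = ∑ k ∈ Finset.range (n + 1), c k * (q ^ (M + 1) / q ^ k) * qpoch q x (k + 1)
        + ∑ k ∈ Finset.range (n + 2),
          c k * ((1 - q ^ (M + 1) / q ^ k) * (1 - α * q * q ^ k)) * qpoch q x k := by
        rw [Finset.sum_range_succ _ (n + 1), hcn]; simp
    _ = _ := by
        rw [Finset.mul_sum, Finset.sum_range_succ' _ (n + 1), Finset.sum_range_succ' _ (n + 1),
          ← add_assoc, ← Finset.sum_add_distrib]
        congr 1
        · refine Finset.sum_congr rfl fun k hk => ?_
          linear_combination (-qpoch q x (k + 1)) * hrec k hk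
        · linear_combination (-qpoch q x 0) * h0

/-- The weight of the affine `q`-Krawtchouk polynomials at the node `q^{-s}`. -/
noncomputable def affineQKrawtchoukWeight (q : ℝ) (M : ℕ) (α : ℝ) (s : ℕ) : ℝ :=
  ∏ j ∈ Finset.range s,
    (1 - α * q * q ^ j) * (1 - q ^ M / q ^ j) / ((1 - q * q ^ j) * (α * q))

theorem affineQKrawtchoukWeight_succ (q : ℝ) (M : ℕ) (α : ℝ) (s : ℕ) :
    affineQKrawtchoukWeight q M α (s + 1) = affineQKrawtchoukWeight q M α s *
      ((1 - α * q * q ^ s) * (1 - q ^ M / q ^ s) / ((1 - q * q ^ s) * (α * q))) :=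
  Finset.prod_range_succ _ _

theorem one_sub_mul_pow_pos {q a : ℝ} (hq0 : 0 < q) (hq1 : q < 1) (ha : 0 < a) (ha1 : a < 1)
    (j : ℕ) : 0 < 1 - a * q ^ j := by
  have : a * q ^ j ≤ a * 1 := by gcongr; exact pow_le_one₀ hq0.le hq1.le
  linarith

theorem affineQKrawtchoukWeight_pos {q : ℝ} (hq0 : 0 < q) (hq1 : q < 1) {M : ℕ} {α : ℝ}
    (hα : 0 < α) (hα1 : α * q < 1) {s : ℕ} (hs : s ≤ M) :
    0 < affineQKrawtchoukWeight q M α s := by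
  refine Finset.prod_pos fun j hj => ?_
  have hj : j < M := (Finset.mem_range.1 hj).trans_le hs
  have h1 := one_sub_mul_pow_pos hq0 hq1 (mul_pos hα hq0) hα1 j
  have h2 := one_sub_mul_pow_pos hq0 hq1 hq0 hq1 j
  have h3 : 0 < 1 - q ^ M / q ^ j := by
    rw [sub_pos, div_lt_one (pow_pos hq0 j)]
    exact pow_lt_pow_right_of_lt_one₀ hq0 hq1 hj
  positivity

theorem affineQKrawtchoukWeight_shift {q : ℝ} (hq0 : 0 < q) (hq1 : q < 1) (M : ℕ) {α : ℝ}
    (hα : 0 < α) (s : ℕ) :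
    q ^ s * affineQKrawtchoukWeight q M (α * q) s * ((1 - q ^ (M + 1)) * (1 - α * q)) =
      affineQKrawtchoukWeight q (M + 1) α s *
        ((1 - α * q * q ^ s) * (1 - q ^ (M + 1) / q ^ s)) := by
  induction s with
  | zero => simp [affineQKrawtchoukWeight]; ring
  | succ s ih =>
    have h2 := (one_sub_mul_pow_pos hq0 hq1 hq0 hq1 s).ne'
    have e3 : q ^ (M + 1) / q ^ (s + 1) = q ^ M / q ^ s := by
      rw [pow_succ, pow_succ, mul_div_mul_right _ _ hq0.ne']
    rw [affineQKrawtchoukWeight_succ, affineQKrawtchoukWeight_succ, e3]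
    calc _ = (q ^ s * affineQKrawtchoukWeight q M (α * q) s
          * ((1 - q ^ (M + 1)) * (1 - α * q))) *
          ((1 - α * q * q * q ^ s) * (1 - q ^ M / q ^ s) / ((1 - q * q ^ s) * (α * q))) := by
          field_simp
          ring
      _ = _ := by
          rw [ih]; ring

theorem sum_range_sub_mul_add (B g : ℕ → ℝ) (M : ℕ) :
    ∑ s ∈ Finset.range M, (B (s + 1) - B s) * g (s + 1) + B 0 * g 0 =
      B M * g M - ∑ s ∈ Finset.range M, B s * (g (s + 1) - g s) := by
  induction M with
  | zero => simp
  | succ M ih =>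
    rw [Finset.sum_range_succ, Finset.sum_range_succ]
    linear_combination ih

theorem affineQKrawtchoukPoly_orthogonal_pow {q : ℝ} (hq0 : 0 < q) (hq1 : q < 1) (n : ℕ) :
    ∀ (M m : ℕ) (α : ℝ), 0 < α → α * q < 1 → n ≤ M → m < n →
      ∑ s ∈ Finset.range (M + 1), affineQKrawtchoukWeight q M α s *
        affineQKrawtchoukPoly q (M + 1) n α (q⁻¹ ^ s) * (q⁻¹ ^ s) ^ m = 0 := by
  induction n with
  | zero => intro M m α _ _ _ h; omega
  | succ n ih =>
    intro M m α hα hα1 hnM hm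
    obtain ⟨M, rfl⟩ : ∃ M', M = M' + 1 := ⟨M - 1, by omega⟩
    have hnM : n ≤ M := by omega
    have hq := hq0.ne'
    have hK : (1 - q ^ (M + 1)) * (1 - α * q) ≠ 0 := by
      have : 0 < 1 - q ^ (M + 1) := sub_pos.2 (pow_lt_one₀ hq0.le hq1 (Nat.succ_ne_zero M))
      have : 0 < 1 - α * q := by linarith
      positivity
    set w := affineQKrawtchoukWeight q (M + 1) α with hw
    set B : ℕ → ℝ := fun s => w s * ((1 - α * q * q ^ s) * (1 - q ^ (M + 1) / q ^ s)) *
      affineQKrawtchoukPoly q (M + 1) n (α * q) (q⁻¹ ^ s) with hB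
    have hback := fun s : ℕ => affineQKrawtchoukPoly_backward hq0 hq1 M n hnM hα hα1
      (pow_ne_zero s (inv_ne_zero hq))
    have hB0 : (1 - q ^ (M + 1)) * (1 - α * q) *
        (w 0 * affineQKrawtchoukPoly q (M + 2) (n + 1) α (q⁻¹ ^ 0)) = B 0 := by
      have := hback 0
      simp only [pow_zero, div_one, sub_self, mul_zero, zero_mul, sub_zero, mul_one] at this
      simp only [hB, pow_zero, div_one, mul_one]
      linear_combination (-w 0) * this
    have hBs : ∀ s, (1 - q ^ (M + 1)) * (1 - α * q) *
        (w (s + 1) * affineQKrawtchoukPoly q (M + 2) (n + 1) α (q⁻¹ ^ (s + 1))) =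
          B (s + 1) - B s := by
      intro s
      have h := hback (s + 1)
      have e1 : q⁻¹ ^ (s + 1) * q = q⁻¹ ^ s := by rw [pow_succ]; field_simp
      have e2 : w (s + 1) * (α * q * (1 - q * q ^ s)) =
          w s * ((1 - α * q * q ^ s) * (1 - q ^ (M + 1) / q ^ s)) := by
        have h2 := (one_sub_mul_pow_pos hq0 hq1 hq0 hq1 s).ne'
        rw [hw, affineQKrawtchoukWeight_succ]
        field_simp
      have e3 : (1 : ℝ) / q⁻¹ ^ (s + 1) = q * q ^ s := by
        rw [inv_pow, one_div, inv_inv, pow_succ']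
      have e4 : α * q / q⁻¹ ^ (s + 1) = α * q * q ^ (s + 1) := by
        rw [inv_pow, div_inv_eq_mul]
      have e5 : q ^ (M + 1) * q⁻¹ ^ (s + 1) = q ^ (M + 1) / q ^ (s + 1) := by
        rw [inv_pow, div_eq_mul_inv]
      rw [e1, e3, e4, e5] at h
      simp only [hB]
      linear_combination (-w (s + 1)) * h -
        affineQKrawtchoukPoly q (M + 1) n (α * q) (q⁻¹ ^ s) * e2
    have hBM : B (M + 1) = 0 := by
      simp [hB, pow_ne_zero (M + 1) hq]
    have hsum := sum_range_sub_mul_add B (fun s => (q⁻¹ ^ s) ^ m) (M + 1)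
    rw [hBM] at hsum
    have hzero : ∑ s ∈ Finset.range (M + 1),
        B s * ((q⁻¹ ^ (s + 1)) ^ m - (q⁻¹ ^ s) ^ m) = 0 := by
      rcases m with _ | m
      · simp
      · have := ih M m (α * q) (by positivity) (by nlinarith) hnM (by omega)
        rw [← mul_zero ((q⁻¹ ^ (m + 1) - 1) * ((1 - q ^ (M + 1)) * (1 - α * q))), ← this,
          Finset.mul_sum]
        refine Finset.sum_congr rfl fun s _ => ?_
        have e := affineQKrawtchoukWeight_shift hq0 hq1 M hα s
        simp only [hB, hw, ← e]
        have : q ^ s * q⁻¹ ^ s = 1 := by rw [← mul_pow, mul_inv_cancel₀ hq, one_pow]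
        generalize affineQKrawtchoukWeight q M (α * q) s = W
        generalize affineQKrawtchoukPoly q (M + 1) n (α * q) (q⁻¹ ^ s) = P
        have e2 : (q⁻¹ ^ (s + 1)) ^ (m + 1) = (q⁻¹ ^ s) ^ (m + 1) * q⁻¹ ^ (m + 1) := by
          rw [pow_succ q⁻¹ s, mul_pow]
        rw [e2, pow_succ (q⁻¹ ^ s)]
        linear_combination (W * P * ((1 - q ^ (M + 1)) * (1 - α * q)) * (q⁻¹ ^ s) ^ m *
          (q⁻¹ ^ (m + 1) - 1)) * this
    rw [hzero, zero_mul, sub_zero] at hsum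
    refine (mul_eq_zero.1 ?_).resolve_left hK
    rw [Finset.sum_range_succ', mul_add, Finset.mul_sum, ← hsum]
    congr 1
    · refine Finset.sum_congr rfl fun s _ => ?_
      rw [← hBs]; ring
    · rw [← hB0]; ring

/-- `p` is orthogonal, for the weights `w` at the nodes `ξ 0, …, ξ (N - 1)`, to every polynomial
of degree less than `n`. -/
def IsDiscreteOrthogonal (N n : ℕ) (ξ w : ℕ → ℝ) (p : ℝ[X]) : Prop :=
  ∀ g : ℝ[X], g.degree < n → ∑ s ∈ Finset.range N, w s * (p.eval (ξ s) * g.eval (ξ s)) = 0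

theorem IsDiscreteOrthogonal.of_C_mul {N n : ℕ} {ξ w : ℕ → ℝ} {p : ℝ[X]} {c : ℝ} (hc : c ≠ 0)
    (h : IsDiscreteOrthogonal N n ξ w (C c * p)) : IsDiscreteOrthogonal N n ξ w p := by
  intro g hg
  have := h g hg
  refine (mul_eq_zero.1 ?_).resolve_left hc
  rw [← this, Finset.mul_sum]
  refine Finset.sum_congr rfl fun s _ => ?_
  rw [eval_mul, eval_C]; ring

theorem isDiscreteOrthogonal_of_pow {N n : ℕ} {ξ w : ℕ → ℝ} {p : ℝ[X]}
    (h : ∀ m < n, ∑ s ∈ Finset.range N, w s * p.eval (ξ s) * ξ s ^ m = 0) :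
    IsDiscreteOrthogonal N n ξ w p := by
  intro g hg
  have hg' : ∀ x, g.eval x = ∑ m ∈ Finset.range n, g.coeff m * x ^ m := by
    intro x
    rcases n with _ | n
    · have : g = 0 := by
        rw [← degree_eq_bot]; exact Nat.WithBot.lt_zero_iff.1 (by simpa using hg)
      simp [this]
    · refine eval_eq_sum_range' ?_ x
      rcases eq_or_ne g 0 with rfl | h0
      · simp
      · exact (natDegree_lt_iff_degree_lt h0).2 hg
  simp only [hg', Finset.mul_sum]
  rw [Finset.sum_comm]
  refine Finset.sum_eq_zero fun m hm => ?_
  rw [← mul_zero (g.coeff m), ← h m (Finset.mem_range.1 hm), Finset.mul_sum]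
  exact Finset.sum_congr rfl fun s _ => by ring

theorem exists_node_eval_ne_zero {ξ : ℕ → ℝ} (hξ : StrictMono ξ) {f : ℝ[X]} (hf : f ≠ 0)
    {t : Finset ℕ} (hN : f.natDegree < t.card) :
    ∃ s ∈ t, f.eval (ξ s) ≠ 0 := by
  by_contra! h
  refine hf (eq_zero_of_natDegree_lt_card_of_eval_eq_zero' f (t.image ξ) ?_ ?_)
  · simpa using h
  · rwa [Finset.card_image_of_injective _ hξ.injective]

/-- A real polynomial times the linear factors of its roots of odd multiplicity has constant
sign. -/
theorem exists_eval_mul_prod_nonneg {p : ℝ[X]} (hp : p ≠ 0) :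
    ∃ e : ℝ, e ≠ 0 ∧ ∀ x, 0 ≤ e * (p.eval x *
      (∏ a ∈ p.roots.toFinset with Odd (p.roots.count a), (X - C a)).eval x) := by
  obtain ⟨h, hph, -, hh⟩ := exists_prod_multiset_X_sub_C_mul p
  have h0 : h ≠ 0 := by rintro rfl; simp at hph; exact hp hph.symm
  have hne : ∀ x, h.eval x ≠ 0 := by
    intro x hx
    have : x ∈ h.roots := (mem_roots h0).2 hx
    simp [hh] at this
  have hsign : ∀ x, 0 < h.eval 0 * h.eval x := by
    intro x
    by_contra! hx
    have hc : ContinuousOn (fun t => h.eval 0 * h.eval t) (Set.uIcc 0 x) := by fun_prop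
    have := intermediate_value_uIcc hc
    have h1 : (0 : ℝ) ∈ Set.uIcc (h.eval 0 * h.eval 0) (h.eval 0 * h.eval x) :=
      Set.mem_uIcc.2 (Or.inr ⟨hx, mul_self_nonneg _⟩)
    obtain ⟨t, -, ht⟩ := this h1
    exact (mul_ne_zero (hne 0) (hne t)) ht
  refine ⟨h.eval 0, hne 0, fun x => ?_⟩
  have hpx : p.eval x = (∏ a ∈ p.roots.toFinset, (x - a) ^ p.roots.count a) * h.eval x := by
    conv_lhs => rw [← hph]
    rw [eval_mul, eval_multiset_prod, Multiset.map_map, Finset.prod_multiset_map_count]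
    simp
  rw [hpx, eval_prod, Finset.prod_filter]
  have : ∀ A E H D : ℝ, E * (A * H * D) = (E * H) * (A * D) := fun _ _ _ _ => by ring
  rw [this, ← Finset.prod_mul_distrib]
  refine mul_nonneg (hsign x).le (Finset.prod_nonneg fun a _ => ?_)
  split_ifs with ho
  · rw [eval_sub, eval_X, eval_C, ← pow_succ]
    exact (ho.add_one).pow_nonneg _
  · rw [mul_one]
    exact (Nat.not_odd_iff_even.1 ho).pow_nonneg _

/-- An orthogonal polynomial has as many distinct real zeros as its degree. -/
theorem IsDiscreteOrthogonal.exists_strictMono_roots {N n : ℕ} {ξ w : ℕ → ℝ} (hξ : StrictMono ξ)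
    (hw : ∀ s < N, 0 < w s) {p : ℝ[X]} (hp : p ≠ 0) (hpn : p.natDegree = n) (hnN : n < N)
    (h : IsDiscreteOrthogonal N n ξ w p) :
    ∃ x : Fin n → ℝ, StrictMono x ∧ p = C p.leadingCoeff * ∏ i, (X - C (x i)) := by
  obtain ⟨e, he, hpos⟩ := exists_eval_mul_prod_nonneg hp
  set T := {a ∈ p.roots.toFinset | Odd (p.roots.count a)} with hT
  set g : ℝ[X] := ∏ a ∈ T, (X - C a) with hg
  have hTn : n ≤ T.card := by
    by_contra! hlt
    have hgd : g.degree < n := by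
      rw [hg, degree_prod]; simpa using hlt
    have hs := h g hgd
    obtain ⟨s, hs1, hs2⟩ := exists_node_eval_ne_zero hξ hp
      (t := Finset.range N) (by simpa [hpn] using hnN)
    have h0 : ∑ s ∈ Finset.range N, w s * (e * (p.eval (ξ s) * g.eval (ξ s))) = 0 := by
      rw [← mul_zero e, ← hs, Finset.mul_sum]
      exact Finset.sum_congr rfl fun s _ => by ring
    rw [Finset.sum_eq_zero_iff_of_nonneg
      fun s hs => mul_nonneg (hw s (Finset.mem_range.1 hs)).le (hpos _)] at h0
    have h1 := h0 s hs1
    have hws := (hw s (Finset.mem_range.1 hs1)).ne'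
    have hgs : g.eval (ξ s) = 0 := by simpa [hws, he, hs2] using h1
    rw [hg, eval_prod, Finset.prod_eq_zero_iff] at hgs
    obtain ⟨a, ha, hax⟩ := hgs
    have : ξ s = a := by simpa [sub_eq_zero] using hax
    rw [hT, Finset.mem_filter, Multiset.mem_toFinset, mem_roots hp] at ha
    exact hs2 (this ▸ ha.1)
  have hroots : p.roots.toFinset.card = n := by
    refine le_antisymm ?_ (hTn.trans (Finset.card_le_card (Finset.filter_subset _ _)))
    rw [← hpn]
    exact (Multiset.toFinset_card_le _).trans (card_roots' p)
  have hcard : Multiset.card p.roots = n := by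
    refine le_antisymm (hpn ▸ card_roots' p) ?_
    conv_lhs => rw [← hroots]
    exact Multiset.toFinset_card_le _
  have hnodup : p.roots.Nodup := by
    rw [← Multiset.toFinset_card_eq_card_iff_nodup, hroots, hcard]
  refine ⟨p.roots.toFinset.orderEmbOfFin hroots, OrderEmbedding.strictMono _, ?_⟩
  conv_lhs => rw [← C_leadingCoeff_mul_prod_multiset_X_sub_C (hcard.trans hpn.symm)]
  congr 1
  have h1 : (p.roots.map fun a => X - C a).prod = ∏ a ∈ p.roots.toFinset, (X - C a) := by
    rw [Finset.prod, Multiset.toFinset_val, hnodup.dedup]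
  rw [h1]
  conv_lhs => rw [← Finset.image_orderEmbOfFin_univ p.roots.toFinset hroots]
  rw [Finset.prod_image fun _ _ _ _ h => (RelEmbedding.injective _) h]

/-- The sign comparison behind Markov's theorem on monotonicity of zeros: `r = (X - y) f` and `p`
are orthogonal polynomials for the weights `v` and `w`, where `v / w` is strictly monotone in the
direction given by the sign of `e`. -/
theorem IsDiscreteOrthogonal.markov_sign {N n : ℕ} {ξ w v : ℕ → ℝ} (hξ : StrictMono ξ)
    (hw : ∀ s < N, 0 < w s) (hv : ∀ s < N, 0 < v s) {p f : ℝ[X]} {y e : ℝ}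
    (hf : f ≠ 0) (hfn : f.natDegree + 1 = n) (hpn : p.natDegree = n) (hnN : n < N)
    (hp : IsDiscreteOrthogonal N n ξ w p)
    (hr : IsDiscreteOrthogonal N n ξ v ((X - C y) * f))
    (hmono : ∀ s t, s < t → t < N → 0 < e * (v t * w s - v s * w t))
    (hsign : ∀ s < N, ((X - C y) * f).eval (ξ s) ≠ 0 →
      0 < p.eval (ξ s) * ((X - C y) * f).eval (ξ s)) :
    0 < e * (p.eval y * f.eval y) := by
  have hdivX : ∀ g : ℝ[X], g.natDegree ≤ n → ∃ k : ℝ[X], k.degree < n ∧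
      ∀ x, g.eval x - g.eval y = (x - y) * k.eval x := by
    intro g hgn
    refine ⟨g /ₘ (X - C y), ?_, fun x => ?_⟩
    · by_cases h0 : g /ₘ (X - C y) = 0
      · rw [h0, degree_zero]; exact WithBot.bot_lt_coe _
      · rw [← natDegree_lt_iff_degree_lt h0, natDegree_divByMonic _ (monic_X_sub_C y),
          natDegree_X_sub_C]
        omega
    · have := congrArg (eval x) (modByMonic_add_div g (X - C y))
      rw [modByMonic_X_sub_C_eq_C_eval] at this
      simp only [eval_add, eval_C, eval_mul, eval_sub, eval_X] at this
      linarith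
  have hfd : f.degree < n := by
    rw [← natDegree_lt_iff_degree_lt hf]; omega
  -- Gauss-type quadrature at the zero `y`
  have hquad : ∀ g : ℝ[X], g.natDegree ≤ n → ∑ s ∈ Finset.range N,
      v s * (g.eval (ξ s) * f.eval (ξ s)) = g.eval y * ∑ s ∈ Finset.range N, v s * f.eval (ξ s) := by
    intro g hgn
    obtain ⟨k, hk, hkx⟩ := hdivX g hgn
    have := hr k hk
    rw [← sub_eq_zero, ← this, Finset.mul_sum, ← Finset.sum_sub_distrib]
    refine Finset.sum_congr rfl fun s _ => ?_
    rw [eval_mul, eval_sub, eval_X, eval_C]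
    linear_combination v s * f.eval (ξ s) * hkx (ξ s)
  obtain ⟨s₀, hs₀, hlt, hgt⟩ : ∃ s₀ < N, (∀ s < s₀, ξ s < y) ∧ ∀ s, s₀ < s → s < N → y < ξ s := by
    by_cases hex : ∃ s, y ≤ ξ s ∧ s < N
    · classical
      refine ⟨Nat.find hex, (Nat.find_spec hex).2, fun s hs => ?_, fun s hs _ => ?_⟩
      · by_contra! hc
        exact Nat.find_min hex hs ⟨hc, hs.trans (Nat.find_spec hex).2⟩
      · exact (Nat.find_spec hex).1.trans_lt (hξ hs)
    · push Not at hex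
      refine ⟨N - 1, by omega, fun s hs => ?_, fun s hs _ => by omega⟩
      by_contra! hc
      have := hex s hc
      omega
  have hA := hquad p hpn.le
  have hB := hquad f (by omega)
  set S := ∑ s ∈ Finset.range N, v s * f.eval (ξ s)
  have hBpos : 0 < f.eval y * S := by
    rw [← hB]
    obtain ⟨s, hs, hfs⟩ := exists_node_eval_ne_zero hξ hf (t := Finset.range N)
      (by simp; omega)
    exact Finset.sum_pos' (fun s hs => mul_nonneg (hv s (Finset.mem_range.1 hs)).le
      (mul_self_nonneg _)) ⟨s, hs, mul_pos (hv s (Finset.mem_range.1 hs)) (mul_self_pos.2 hfs)⟩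
  have hApos : 0 < e * (w s₀ * (p.eval y * S)) := by
    have hsum : e * (w s₀ * (p.eval y * S)) = ∑ s ∈ Finset.range N,
        e * (v s * w s₀ - v s₀ * w s) * (p.eval (ξ s) * f.eval (ξ s)) := by
      have h2 := hp f hfd
      calc _ = e * (w s₀ * (p.eval y * S)) - e * v s₀ * 0 := by ring
        _ = _ := by
          rw [← hA, ← h2, Finset.mul_sum, Finset.mul_sum, Finset.mul_sum,
            ← Finset.sum_sub_distrib]
          exact Finset.sum_congr rfl fun s _ => by ring
    rw [hsum]
    have hterm : ∀ s < N, s ≠ s₀ → f.eval (ξ s) ≠ 0 →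
        0 < e * (v s * w s₀ - v s₀ * w s) * (p.eval (ξ s) * f.eval (ξ s)) := by
      intro s hs hne hfs
      have hE : 0 < e * (v s * w s₀ - v s₀ * w s) * (ξ s - y) := by
        rcases lt_or_gt_of_ne hne with h | h
        · have h1 := hmono s s₀ h hs₀
          have h2 := hlt s h
          nlinarith
        · have h1 := hmono s₀ s h hs
          have h2 := hgt s h hs
          exact mul_pos h1 (by linarith)
      have hxy : ξ s - y ≠ 0 := fun h0 => by rw [h0, mul_zero] at hE; exact hE.false
      have h3 := hsign s hs (by simpa [hfs] using hxy)
      rw [eval_mul, eval_sub, eval_X, eval_C] at h3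
      have h4 := mul_pos hE h3
      have h5 : 0 < (ξ s - y) ^ 2 := by positivity
      refine (pos_iff_pos_of_mul_pos ?_).1 h5
      linarith
    refine Finset.sum_pos' (fun s hs => ?_) ?_
    · rcases eq_or_ne s s₀ with rfl | hne
      · simp
      · rcases eq_or_ne (f.eval (ξ s)) 0 with h0 | h0
        · simp [h0]
        · exact (hterm s (Finset.mem_range.1 hs) hne h0).le
    · obtain ⟨s, hs, hfs⟩ := exists_node_eval_ne_zero hξ hf
        (t := (Finset.range N).erase s₀)
        (by rw [Finset.card_erase_of_mem (Finset.mem_range.2 hs₀), Finset.card_range]; omega)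
      rw [Finset.mem_erase] at hs
      exact ⟨s, hs.2, hterm s (Finset.mem_range.1 hs.2) hs.1 hfs⟩
  have hprod := mul_pos hApos hBpos
  have hS : 0 < w s₀ * S ^ 2 := by
    have : S ≠ 0 := by rintro h; rw [h, mul_zero] at hBpos; exact hBpos.false
    have := hw s₀ hs₀
    positivity
  refine (pos_iff_pos_of_mul_pos ?_).1 hS
  linarith

theorem Fin.eq_id_of_strictMono {n : ℕ} {i : Fin n → Fin n} (hi : StrictMono i) (j : Fin n) :
    i j = j := by
  have : i = id := by
    rw [← StrictMono.range_inj hi strictMono_id,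
       (Finite.injective_iff_surjective.1 hi.injective).range_eq, Set.range_id]
  rw [this, id]

theorem lt_of_prod_sub_mul_neg {n : ℕ} {x y : Fin n → ℝ} (hx : StrictMono x) (hy : StrictMono y)
    (h : ∀ j, (∏ i, (y j - x i)) * ∏ i ∈ Finset.univ.erase j, (y j - y i) < 0) (j : Fin n) :
    y j < x j := by
  have key : ∀ j, ∃ i, y j < x i ∧ ∀ k, j < k → x i < y k := by
    intro j
    by_cases hj : (j : ℕ) + 1 < n
    · set k : Fin n := ⟨j + 1, hj⟩ with hk
      have hjk : j < k := by rw [Fin.lt_def]; simp [hk]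
      suffices ∃ i, y j < x i ∧ x i < y k by
        obtain ⟨i, h1, h2⟩ := this
        refine ⟨i, h1, fun l hl => h2.trans_le (hy.monotone ?_)⟩
        rw [Fin.lt_def] at hl
        rw [Fin.le_def, hk]
        exact hl
      by_contra! hc
      have h1 : 0 ≤ (∏ i, (y j - x i)) * ∏ i, (y k - x i) := by
        rw [← Finset.prod_mul_distrib]
        refine Finset.prod_nonneg fun i _ => ?_
        have := hy hjk
        rcases le_or_gt (x i) (y j) with h | h
        · exact mul_nonneg (by linarith) (by linarith)
        · exact mul_nonneg_of_nonpos_of_nonpos (by linarith) (by linarith [hc i h])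
      have h2 : (∏ i ∈ Finset.univ.erase j, (y j - y i)) *
          ∏ i ∈ Finset.univ.erase k, (y k - y i) < 0 := by
        rw [← Finset.mul_prod_erase (Finset.univ.erase j) _
            (Finset.mem_erase.2 ⟨hjk.ne', Finset.mem_univ k⟩),
          ← Finset.mul_prod_erase (Finset.univ.erase k) _
            (Finset.mem_erase.2 ⟨hjk.ne, Finset.mem_univ j⟩), Finset.erase_right_comm]
        have h3 : 0 < (∏ i ∈ (Finset.univ.erase k).erase j, (y j - y i)) *
            ∏ i ∈ (Finset.univ.erase k).erase j, (y k - y i) := by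
          rw [← Finset.prod_mul_distrib]
          refine Finset.prod_pos fun i hi => ?_
          simp only [Finset.mem_erase, Finset.mem_univ, and_true] at hi
          rcases lt_or_gt_of_ne hi.1 with h | h
          · exact mul_pos (by linarith [hy h]) (by linarith [hy h, hy hjk])
          · have hki : k < i := by
              refine lt_of_le_of_ne ?_ (Ne.symm hi.2)
              rw [Fin.lt_def] at h
              rw [Fin.le_def, hk]
              exact h
            exact mul_pos_of_neg_of_neg (by linarith [hy hki, hy hjk]) (by linarith [hy hki])
        have := hy hjk
        nlinarith [mul_pos h3 (pow_pos (sub_pos.2 this) 2)]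
      have h3 := mul_pos_of_neg_of_neg (h j) (h k)
      have h4 := mul_nonpos_of_nonneg_of_nonpos h1 h2.le
      linarith
    · have hlast : ∀ k, k ≤ j := fun k => by rw [Fin.le_def]; omega
      suffices ∃ i, y j < x i by
        obtain ⟨i, h1⟩ := this
        exact ⟨i, h1, fun k hk => absurd hk (hlast k).not_gt⟩
      by_contra! hc
      have h1 : 0 ≤ ∏ i, (y j - x i) := Finset.prod_nonneg fun i _ => sub_nonneg.2 (hc i)
      have h2 : 0 ≤ ∏ i ∈ Finset.univ.erase j, (y j - y i) :=
        Finset.prod_nonneg fun i _ => sub_nonneg.2 (hy.monotone (hlast i))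
      exact (mul_nonneg h1 h2).not_gt (h j)
  choose i hi1 hi2 using key
  have hi : StrictMono i := fun a b hab =>
    hx.lt_iff_lt.1 ((hi2 a b hab).trans (hi1 b))
  have := hi1 j
  rwa [Fin.eq_id_of_strictMono hi j] at this

theorem lt_of_prod_sub_mul_pos {n : ℕ} {x y : Fin n → ℝ} (hx : StrictMono x) (hy : StrictMono y)
    (h : ∀ j, 0 < (∏ i, (y j - x i)) * ∏ i ∈ Finset.univ.erase j, (y j - y i)) (j : Fin n) :
    x j < y j := by
  have := lt_of_prod_sub_mul_neg (x := fun i => -x i.rev) (y := fun i => -y i.rev)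
    (fun a b hab => neg_lt_neg (hx (Fin.rev_lt_rev.2 hab)))
    (fun a b hab => neg_lt_neg (hy (Fin.rev_lt_rev.2 hab))) ?_ j.rev
  · simpa using this
  · intro j
    have h1 : ∏ i : Fin n, (-y j.rev - -x i.rev) = ∏ i, -(y j.rev - x i) :=
      Fintype.prod_equiv Fin.revPerm _ _ fun i => by simp; ring
    have h2 : ∏ i ∈ Finset.univ.erase j, (-y j.rev - -y i.rev) =
        ∏ i ∈ Finset.univ.erase j.rev, -(y j.rev - y i) :=
      Finset.prod_equiv Fin.revPerm (fun i => by simp [Fin.rev_inj]) fun i _ => by simp; ring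
    rw [h1, h2, Finset.prod_neg, Finset.prod_neg, Finset.card_erase_of_mem (Finset.mem_univ _),
      Finset.card_univ, Fintype.card_fin]
    have hn : (-1 : ℝ) ^ n * (-1) ^ (n - 1) = -1 := by
      obtain ⟨m, rfl⟩ : ∃ m, n = m + 1 := ⟨n - 1, by have := j.2; omega⟩
      rw [Nat.add_sub_cancel, pow_succ, mul_right_comm, ← mul_pow]; simp
    have := h j.rev
    calc _ = (-1 : ℝ) ^ n * (-1) ^ (n - 1) * ((∏ i, (y j.rev - x i)) *
          ∏ i ∈ Finset.univ.erase j.rev, (y j.rev - y i)) := by ring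
      _ < 0 := by rw [hn]; linarith

/-- A function that is strictly decreasing at every point of an open interval is strictly
decreasing on it. -/
theorem strictAntiOn_Ioo_of_eventually {f : ℝ → ℝ} {a b : ℝ}
    (h : ∀ t ∈ Set.Ioo a b, ∀ᶠ s in nhds t, (s < t → f t < f s) ∧ (t < s → f s < f t)) :
    StrictAntiOn f (Set.Ioo a b) := by
  intro u hu v hv huv
  have hsub : ∀ t ∈ Set.Icc u v, t ∈ Set.Ioo a b := fun t ht =>
    ⟨hu.1.trans_le ht.1, ht.2.trans_lt hv.2⟩
  set S := {t ∈ Set.Icc u v | ∀ s ∈ Set.Ioc u t, f s < f u} with hS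
  have huS : u ∈ S := ⟨⟨le_rfl, huv.le⟩, fun s hs => absurd hs.1 hs.2.not_gt⟩
  have hbdd : BddAbove S := ⟨v, fun t ht => ht.1.2⟩
  set c := sSup S
  have hc : c ∈ Set.Icc u v := ⟨le_csSup hbdd huS, csSup_le ⟨u, huS⟩ fun t ht => ht.1.2⟩
  have hbelow : ∀ s, u < s → s < c → f s < f u := by
    intro s hus hsc
    obtain ⟨t, ht, hst⟩ := exists_lt_of_lt_csSup ⟨u, huS⟩ hsc
    exact ht.2 s ⟨hus, hst.le⟩
  obtain ⟨ε, hε, hball⟩ := Metric.eventually_nhds_iff.1 (h c (hsub c hc))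
  have hcle : ∀ s ∈ Set.Ioc u c, f s < f u := by
    intro s hs
    rcases hs.2.lt_or_eq with hlt | rfl
    · exact hbelow s hs.1 hlt
    · have hm : max u (c - ε / 2) < c := max_lt hs.1 (by linarith)
      obtain ⟨t, ht1, ht2⟩ := exists_between hm
      have ht3 := max_lt_iff.1 ht1
      have hd : dist t c < ε := by
        rw [Real.dist_eq, abs_lt]; constructor <;> linarith [ht3.2]
      exact ((hball hd).1 ht2).trans (hbelow t ht3.1 ht2)
  have hfc : f c ≤ f u := by
    rcases hc.1.lt_or_eq with hlt | heq
    · exact (hcle c ⟨hlt, le_rfl⟩).le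
    · rw [← heq]
  rcases hc.2.lt_or_eq with hlt | heq
  · exfalso
    have hm : c < min v (c + ε / 2) := lt_min hlt (by linarith)
    have hmem : min v (c + ε / 2) ∈ S := by
      refine ⟨⟨hc.1.trans hm.le, min_le_left _ _⟩, fun s hs => ?_⟩
      rcases le_or_gt s c with hsc | hsc
      · exact hcle s ⟨hs.1, hsc⟩
      · have hd : dist s c < ε := by
          have := hs.2.trans (min_le_right _ _)
          rw [Real.dist_eq, abs_lt]; constructor <;> linarith
        exact ((hball hd).2 hsc).trans_le hfc
    exact (le_csSup hbdd hmem).not_gt hm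
  · rw [← heq]
    exact hcle c ⟨by rw [heq]; exact huv, le_rfl⟩

theorem affineQKrawtchoukWeight_ratio {q : ℝ} (hq0 : 0 < q) (hq1 : q < 1) {M : ℕ} {α β : ℝ}
    (hα : 0 < α) (hαβ : α < β) (hβ1 : β * q < 1) {k l : ℕ} (hkl : k < l) (hl : l ≤ M) :
    affineQKrawtchoukWeight q M β l * affineQKrawtchoukWeight q M α k <
      affineQKrawtchoukWeight q M β k * affineQKrawtchoukWeight q M α l := by
  have hα1 : α * q < 1 := lt_trans (by gcongr) hβ1
  have hβ := hα.trans hαβ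
  have hstep : ∀ j < M,
      0 < (1 - β * q * q ^ j) * (1 - q ^ M / q ^ j) / ((1 - q * q ^ j) * (β * q)) ∧
      (1 - β * q * q ^ j) * (1 - q ^ M / q ^ j) / ((1 - q * q ^ j) * (β * q)) <
      (1 - α * q * q ^ j) * (1 - q ^ M / q ^ j) / ((1 - q * q ^ j) * (α * q)) := by
    intro j hj
    have h1 := one_sub_mul_pow_pos hq0 hq1 (mul_pos hβ hq0) hβ1 j
    have h2 := one_sub_mul_pow_pos hq0 hq1 hq0 hq1 j
    have h3 : 0 < 1 - q ^ M / q ^ j := by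
      rw [sub_pos, div_lt_one (pow_pos hq0 j)]
      exact pow_lt_pow_right_of_lt_one₀ hq0 hq1 hj
    have h4 := one_sub_mul_pow_pos hq0 hq1 (mul_pos hα hq0) hα1 j
    exact ⟨by positivity, by gcongr⟩
  have hmain : ∀ l, k ≤ l → l < M →
      affineQKrawtchoukWeight q M β l * affineQKrawtchoukWeight q M α k ≤
        affineQKrawtchoukWeight q M β k * affineQKrawtchoukWeight q M α l →
      affineQKrawtchoukWeight q M β (l + 1) * affineQKrawtchoukWeight q M α k <
        affineQKrawtchoukWeight q M β k * affineQKrawtchoukWeight q M α (l + 1) := by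
    intro l hkl hlM h
    have h1 := affineQKrawtchoukWeight_pos hq0 hq1 hβ hβ1 hlM.le
    have h2 := affineQKrawtchoukWeight_pos hq0 hq1 hα hα1 (hkl.trans hlM.le)
    rw [affineQKrawtchoukWeight_succ, affineQKrawtchoukWeight_succ, mul_right_comm,
      ← mul_assoc (affineQKrawtchoukWeight q M β k)]
    calc _ < affineQKrawtchoukWeight q M β l * affineQKrawtchoukWeight q M α k * _ :=
          mul_lt_mul_of_pos_left (hstep l hlM).2 (by positivity)
      _ ≤ _ := mul_le_mul_of_nonneg_right h ((hstep l hlM).1.trans (hstep l hlM).2).le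
  induction l, hkl using Nat.le_induction with
  | base => exact hmain k le_rfl hl le_rfl
  | succ l hkl ih =>
    exact hmain l (Nat.le_of_succ_le hkl) hl (ih (Nat.le_of_succ_le hl)).le

theorem qpoch_pos {q a : ℝ} (hq0 : 0 < q) (hq1 : q < 1) (ha : 0 < a) (ha1 : a < 1) (k : ℕ) :
    0 < qpoch q a k :=
  Finset.prod_pos fun j _ => one_sub_mul_pow_pos hq0 hq1 ha ha1 j

theorem qpoch_inv_pow_ne_zero {q : ℝ} (hq0 : 0 < q) (hq1 : q < 1) {k m : ℕ} (hkm : k ≤ m) :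
    qpoch q (q ^ m)⁻¹ k ≠ 0 := by
  refine Finset.prod_ne_zero_iff.2 fun j hj => ?_
  have hj : j < m := (Finset.mem_range.1 hj).trans_le hkm
  have : 1 < (q ^ m)⁻¹ * q ^ j := by
    rw [← div_eq_inv_mul, one_lt_div (pow_pos hq0 m)]
    exact pow_lt_pow_right_of_lt_one₀ hq0 hq1 hj
  linarith

/-- The affine `q`-Krawtchouk polynomial as an element of `ℝ[X]`. -/
noncomputable def affineQKrawtchoukPolynomial (q : ℝ) (M n : ℕ) (α : ℝ) : ℝ[X] :=
  ∑ k ∈ Finset.range (n + 1), C (qhypCoeff q (q ^ n)⁻¹ (q ^ M)⁻¹ (α * q) k) *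
    ∏ j ∈ Finset.range k, (C (-q ^ j) * X + C 1)

theorem affineQKrawtchoukPolynomial_eval (q : ℝ) (M n : ℕ) (α x : ℝ) :
    (affineQKrawtchoukPolynomial q M n α).eval x = affineQKrawtchoukPoly q (M + 1) n α x := by
  rw [affineQKrawtchoukPoly_eq, affineQKrawtchoukPolynomial, eval_finsetSum]
  refine Finset.sum_congr rfl fun k _ => ?_
  rw [eval_mul, eval_C, eval_prod, qpoch]
  congr 1
  refine Finset.prod_congr rfl fun j _ => ?_
  simp
  ring

theorem natDegree_prod_linear {q : ℝ} (hq : q ≠ 0) (k : ℕ) :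
    (∏ j ∈ Finset.range k, (C (-q ^ j) * X + C 1)).natDegree = k := by
  have h : ∀ j, (C (-q ^ j) * X + C 1).natDegree = 1 := fun j =>
    natDegree_linear (neg_ne_zero.2 (pow_ne_zero j hq))
  rw [natDegree_prod _ _ fun j _ h0 => by have := h j; rw [h0, natDegree_zero] at this; omega]
  simp only [h, Finset.sum_const, Finset.card_range, smul_eq_mul, mul_one]

theorem coeff_prod_linear {q : ℝ} (hq : q ≠ 0) (k : ℕ) :
    (∏ j ∈ Finset.range k, (C (-q ^ j) * X + C 1)).coeff k = ∏ j ∈ Finset.range k, (-q ^ j) := by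
  have h : ∀ f : ℝ[X], f.natDegree = k → f.coeff k = f.leadingCoeff := by
    rintro f rfl; exact coeff_natDegree
  rw [h _ (natDegree_prod_linear hq k), leadingCoeff_prod]
  exact Finset.prod_congr rfl fun j _ =>
    leadingCoeff_linear (neg_ne_zero.2 (pow_ne_zero j hq))

theorem affineQKrawtchoukPolynomial_natDegree_le {q : ℝ} (hq : q ≠ 0) (M n : ℕ) (α : ℝ) :
    (affineQKrawtchoukPolynomial q M n α).natDegree ≤ n := by
  refine natDegree_sum_le_of_forall_le _ _ fun k hk => ?_
  refine (natDegree_C_mul_le _ _).trans ?_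
  rw [natDegree_prod_linear hq]
  exact Nat.lt_succ_iff.1 (Finset.mem_range.1 hk)

theorem affineQKrawtchoukPolynomial_coeff {q : ℝ} (hq : q ≠ 0) (M n : ℕ) (α : ℝ) :
    (affineQKrawtchoukPolynomial q M n α).coeff n =
      qhypCoeff q (q ^ n)⁻¹ (q ^ M)⁻¹ (α * q) n * ∏ j ∈ Finset.range n, (-q ^ j) := by
  rw [affineQKrawtchoukPolynomial, Finset.sum_range_succ, coeff_add, finsetSum_coeff,
    Finset.sum_eq_zero, zero_add, coeff_C_mul, coeff_prod_linear hq]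
  intro k hk
  refine coeff_eq_zero_of_natDegree_lt ((natDegree_C_mul_le _ _).trans_lt ?_)
  rw [natDegree_prod_linear hq]
  exact Finset.mem_range.1 hk

theorem affineQKrawtchoukPolynomial_coeff_mul_pos {q : ℝ} (hq0 : 0 < q) (hq1 : q < 1) {M n : ℕ}
    (hnM : n ≤ M) {α β : ℝ} (hα : 0 < α) (hα1 : α * q < 1) (hβ : 0 < β) (hβ1 : β * q < 1) :
    0 < (affineQKrawtchoukPolynomial q M n α).coeff n *
      (affineQKrawtchoukPolynomial q M n β).coeff n := by
  rw [affineQKrawtchoukPolynomial_coeff hq0.ne', affineQKrawtchoukPolynomial_coeff hq0.ne']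
  have h1 := qpoch_pos hq0 hq1 (mul_pos hα hq0) hα1 n
  have h2 := qpoch_pos hq0 hq1 (mul_pos hβ hq0) hβ1 n
  have h3 := qpoch_inv_pow_ne_zero hq0 hq1 (le_refl n)
  have h4 := qpoch_inv_pow_ne_zero hq0 hq1 hnM
  have h5 := (qpoch_pos hq0 hq1 hq0 hq1 n).ne'
  have h6 : ∏ j ∈ Finset.range n, (-q ^ j) ≠ 0 :=
    Finset.prod_ne_zero_iff.2 fun j _ => neg_ne_zero.2 (pow_ne_zero j hq0.ne')
  simp only [qhypCoeff]
  generalize qpoch q (q ^ n)⁻¹ n = a at *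
  generalize qpoch q (q ^ M)⁻¹ n = b at *
  generalize qpoch q q n = c at *
  generalize ∏ j ∈ Finset.range n, (-q ^ j) = d at *
  have : a / (qpoch q (α * q) n * b * c) * q ^ n * d * (a / (qpoch q (β * q) n * b * c) * q ^ n * d)
      = (a * q ^ n * d / (b * c)) ^ 2 / (qpoch q (α * q) n * qpoch q (β * q) n) := by
    field_simp
  rw [this]
  have := pow_ne_zero n hq0.ne'
  positivity

theorem continuousAt_affineQKrawtchoukPoly {q : ℝ} (hq0 : 0 < q) (hq1 : q < 1) {M n : ℕ}
    (hnM : n ≤ M) {α : ℝ} (hα : 0 < α) (hα1 : α * q < 1) (x : ℝ) :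
    ContinuousAt (fun β => affineQKrawtchoukPoly q (M + 1) n β x) α := by
  simp only [affineQKrawtchoukPoly_eq, qhypCoeff]
  refine tendsto_finsetSum _ fun k hk => ?_
  have hk : k ≤ n := Nat.lt_succ_iff.1 (Finset.mem_range.1 hk)
  have hc : ContinuousAt (fun β => qpoch q (β * q) k) α := by
    unfold qpoch; fun_prop
  have h1 := (qpoch_pos hq0 hq1 (mul_pos hα hq0) hα1 k).ne'
  have h4 := qpoch_inv_pow_ne_zero hq0 hq1 (hk.trans hnM)
  have h5 := (qpoch_pos hq0 hq1 hq0 hq1 k).ne'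
  have : ContinuousAt (fun β => qpoch q (q ^ n)⁻¹ k /
      (qpoch q (β * q) k * qpoch q (q ^ M)⁻¹ k * qpoch q q k) * q ^ k * qpoch q x k) α := by
    fun_prop (disch := positivity)
  exact this

theorem affineQKrawtchoukPolynomial_isDiscreteOrthogonal {q : ℝ} (hq0 : 0 < q) (hq1 : q < 1)
    {M n : ℕ} (hnM : n ≤ M) {α : ℝ} (hα : 0 < α) (hα1 : α * q < 1) :
    IsDiscreteOrthogonal (M + 1) n (fun s => q⁻¹ ^ s) (affineQKrawtchoukWeight q M α)
      (affineQKrawtchoukPolynomial q M n α) := by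
  refine isDiscreteOrthogonal_of_pow fun m hm => ?_
  simp only [affineQKrawtchoukPolynomial_eval]
  exact affineQKrawtchoukPoly_orthogonal_pow hq0 hq1 n M m α hα hα1 hnM hm

/-- zeros of affine q-Krawtchouk polynomials: monotonicity in `α`. -/
theorem stmt_12 (q : ℝ) (hq0 : 0 < q) (hq1 : q < 1) (N n : ℕ) (hN : 2 ≤ N) (hn : 1 ≤ n)
    (hnN : n ≤ N - 1) :
    ∃ x : ℝ → Fin n → ℝ,
      (∀ α : ℝ, 0 < α → α < q⁻¹ →
        StrictMono (x α) ∧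
        (∀ j, affineQKrawtchoukPoly q N n α (x α j) = 0) ∧
        (∀ y : ℝ, affineQKrawtchoukPoly q N n α y = 0 → ∃ j, y = x α j)) ∧
      (∀ j, StrictAntiOn (fun α => x α j) (Set.Ioo 0 q⁻¹)) := by
  obtain ⟨M, rfl⟩ : ∃ M, N = M + 1 := ⟨N - 1, by omega⟩
  have hnM : n ≤ M := hnN
  have hq : ∀ α : ℝ, α < q⁻¹ → α * q < 1 := fun α h => by
    rwa [← lt_div_iff₀ hq0, one_div]
  have hξ : StrictMono fun s : ℕ => q⁻¹ ^ s := pow_right_strictMono₀ (one_lt_inv₀ hq0 |>.2 hq1)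
  set P := affineQKrawtchoukPolynomial q M n with hP
  have hcoeff := @affineQKrawtchoukPolynomial_coeff_mul_pos q hq0 hq1 M n hnM
  have hc0 : ∀ α, 0 < α → α < q⁻¹ → (P α).coeff n ≠ 0 := fun α h0 h1 =>
    left_ne_zero_of_mul (hcoeff h0 (hq α h1) h0 (hq α h1)).ne'
  have hwpos : ∀ α, 0 < α → α < q⁻¹ → ∀ s < M + 1, 0 < affineQKrawtchoukWeight q M α s :=
    fun α h0 h1 s hs => affineQKrawtchoukWeight_pos hq0 hq1 h0 (hq α h1) (Nat.lt_succ_iff.1 hs)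
  have hroots : ∀ α : ℝ, 0 < α → α < q⁻¹ → ∃ x : Fin n → ℝ, StrictMono x ∧
      P α = C ((P α).coeff n) * ∏ i, (X - C (x i)) := by
    intro α h0 h1
    have hdeg : (P α).natDegree = n :=
      natDegree_eq_of_le_of_coeff_ne_zero
        (affineQKrawtchoukPolynomial_natDegree_le hq0.ne' M n α) (hc0 α h0 h1)
    have hne : P α ≠ 0 := fun h => hc0 α h0 h1 (by rw [h, coeff_zero])
    have := (affineQKrawtchoukPolynomial_isDiscreteOrthogonal hq0 hq1 hnM h0
      (hq α h1)).exists_strictMono_roots hξ (hwpos α h0 h1) hne hdeg (Nat.lt_succ_of_le hnM)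
    rwa [leadingCoeff, hdeg] at this
  choose! x hxmono hxP using hroots
  have horth : ∀ α, 0 < α → α < q⁻¹ → IsDiscreteOrthogonal (M + 1) n (fun s => q⁻¹ ^ s)
      (affineQKrawtchoukWeight q M α) (∏ i, (X - C (x α i))) := fun α h0 h1 =>
    .of_C_mul (hc0 α h0 h1) (hxP α h0 h1 ▸
      affineQKrawtchoukPolynomial_isDiscreteOrthogonal hq0 hq1 hnM h0 (hq α h1))
  have heval : ∀ α y : ℝ, 0 < α → α < q⁻¹ → affineQKrawtchoukPoly q (M + 1) n α y =
      (P α).coeff n * (∏ i, (X - C (x α i))).eval y := by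
    intro α y h0 h1
    rw [← affineQKrawtchoukPolynomial_eval, ← hP]
    conv_lhs => rw [hxP α h0 h1]
    rw [eval_mul, eval_C]
  have heval_prod : ∀ (t : Finset (Fin n)) (α y : ℝ),
      (∏ i ∈ t, (X - C (x α i))).eval y = ∏ i ∈ t, (y - x α i) := fun t α y => by
    simp [eval_prod]
  refine ⟨x, fun α h0 h1 => ⟨hxmono α h0 h1, fun j => ?_, fun y hy => ?_⟩, fun j => ?_⟩
  · rw [heval α _ h0 h1, heval_prod, Finset.prod_eq_zero (Finset.mem_univ j) (sub_self _),
      mul_zero]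
  · rw [heval α _ h0 h1, heval_prod, mul_eq_zero, Finset.prod_eq_zero_iff] at hy
    obtain ⟨j, -, hj⟩ := hy.resolve_left (hc0 α h0 h1)
    exact ⟨j, sub_eq_zero.1 hj⟩
  refine strictAntiOn_Ioo_of_eventually fun t ht => ?_
  have hnear : ∀ᶠ s in nhds t, ∀ k ∈ Finset.range (M + 1),
      affineQKrawtchoukPoly q (M + 1) n t (q⁻¹ ^ k) ≠ 0 →
      0 < affineQKrawtchoukPoly q (M + 1) n s (q⁻¹ ^ k) *
        affineQKrawtchoukPoly q (M + 1) n t (q⁻¹ ^ k) := by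
    rw [Filter.eventually_all_finset]
    intro k _
    by_cases h : affineQKrawtchoukPoly q (M + 1) n t (q⁻¹ ^ k) = 0
    · exact Filter.Eventually.of_forall fun s hs => absurd h hs
    · have hc := (continuousAt_affineQKrawtchoukPoly hq0 hq1 hnM ht.1 (hq t ht.2)
        (q⁻¹ ^ k)).mul_const (affineQKrawtchoukPoly q (M + 1) n t (q⁻¹ ^ k))
      exact (Filter.Tendsto.eventually_const_lt (mul_self_pos.2 h) hc).mono fun s hs _ => hs
  filter_upwards [hnear, Ioo_mem_nhds ht.1 ht.2] with s hs hs'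
  have hmarkov : ∀ e : ℝ, (∀ k l, k < l → l < M + 1 →
      0 < e * (affineQKrawtchoukWeight q M t l * affineQKrawtchoukWeight q M s k -
        affineQKrawtchoukWeight q M t k * affineQKrawtchoukWeight q M s l)) → ∀ j,
      0 < e * ((∏ i, (x t j - x s i)) * ∏ i ∈ Finset.univ.erase j, (x t j - x t i)) := by
    intro e he j
    have hfac : (X - C (x t j)) * ∏ i ∈ Finset.univ.erase j, (X - C (x t i)) =
        ∏ i, (X - C (x t i)) :=
      Finset.mul_prod_erase Finset.univ (fun i => X - C (x t i)) (Finset.mem_univ j)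
    have := IsDiscreteOrthogonal.markov_sign (n := n) (y := x t j) (e := e)
      (f := ∏ i ∈ Finset.univ.erase j, (X - C (x t i))) hξ (hwpos s hs'.1 hs'.2)
      (hwpos t ht.1 ht.2) (monic_prod_X_sub_C _ _).ne_zero ?_ ?_ (Nat.lt_succ_of_le hnM)
      (horth s hs'.1 hs'.2) (hfac ▸ horth t ht.1 ht.2) he ?_
    · rwa [heval_prod, heval_prod] at this
    · rw [natDegree_finsetProd_X_sub_C_eq_card, Finset.card_erase_of_mem (Finset.mem_univ j),
        Finset.card_univ, Fintype.card_fin]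
      omega
    · rw [natDegree_finsetProd_X_sub_C_eq_card, Finset.card_univ, Fintype.card_fin]
    · intro k hk hne
      rw [hfac] at hne ⊢
      have h := hs k (Finset.mem_range.2 hk)
      rw [heval s _ hs'.1 hs'.2, heval t _ ht.1 ht.2] at h
      have h1 := h (mul_ne_zero (hc0 t ht.1 ht.2) hne)
      refine (pos_iff_pos_of_mul_pos ?_).1 (hcoeff hs'.1 (hq s hs'.2) ht.1 (hq t ht.2))
      linarith
  constructor
  · intro hst
    refine lt_of_prod_sub_mul_neg (hxmono s hs'.1 hs'.2) (hxmono t ht.1 ht.2) (fun j => ?_) j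
    have := hmarkov (-1) (fun k l hkl hl => ?_) j
    · linarith
    · have := affineQKrawtchoukWeight_ratio hq0 hq1 hs'.1 hst (hq t ht.2) hkl
        (Nat.lt_succ_iff.1 hl)
      linarith
  · intro hst
    refine lt_of_prod_sub_mul_pos (hxmono s hs'.1 hs'.2) (hxmono t ht.1 ht.2) (fun j => ?_) j
    have := hmarkov 1 (fun k l hkl hl => ?_) j
    · linarith
    · have := affineQKrawtchoukWeight_ratio hq0 hq1 ht.1 hst (hq s hs'.2) hkl
        (Nat.lt_succ_iff.1 hl)
      linarith
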